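/- A coin system $ = ⟨1, c₂, c₃, c₄, c₅⟩ with five types of coins is non-canonical if and only if one of the following holds: (1) the subsystem ⟨1, c₂, c₃, c₄⟩ is non-canonical and $ is not of the form ⟨1, 2, c₃, c₃ + 1, 2·c₃⟩; (2) the subsystem ⟨1, c₂, c₃, c₄⟩ is canonical and there exists a natural number k with k·c₄ < c₅ < (k+1)·c₄ such that |GRD_$((k+1)·c₄)| > k + 1, where GRD_$ denotes the greedy representation under $. -/

import Mathlib

/-- A coin system `⟨c 1, c 2, …, c m⟩` is a strictly increasing finite sequence of
positive integers with `c 1 = 1` (only the values `c i` for `1 ≤ i ≤ m` matter). -/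
def IsCoinSystem (m : ℕ) (c : ℕ → ℕ) : Prop :=
  c 1 = 1 ∧ ∀ i j, 1 ≤ i → i < j → j ≤ m → c i < c j

/-- `α` is a representation of `x` under the coin system `⟨c 1, …, c m⟩`. -/
def IsRepr (m : ℕ) (c : ℕ → ℕ) (x : ℕ) (α : ℕ → ℕ) : Prop :=
  ∑ i ∈ Finset.Icc 1 m, α i * c i = x

/-- The size of a representation, i.e. the total number of coins used. -/
def reprSize (m : ℕ) (α : ℕ → ℕ) : ℕ :=
  ∑ i ∈ Finset.Icc 1 m, α i

/-- `α` is the greedy representation of `x`: a representation such that for every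
`2 ≤ i ≤ m` the part of the sum using coins smaller than `c i` is `< c i`. -/
def IsGreedy (m : ℕ) (c : ℕ → ℕ) (x : ℕ) (α : ℕ → ℕ) : Prop :=
  IsRepr m c x α ∧
    ∀ i, 2 ≤ i → i ≤ m → ∑ j ∈ Finset.Icc 1 (i - 1), α j * c j < c i

/-- `α` is an optimal (minimum-size) representation of `x`. -/
def IsOpt (m : ℕ) (c : ℕ → ℕ) (x : ℕ) (α : ℕ → ℕ) : Prop :=
  IsRepr m c x α ∧ ∀ β, IsRepr m c x β → reprSize m α ≤ reprSize m β

/-- `x` is a counterexample: the greedy representation of `x` is strictly larger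
than some representation of `x` (equivalently, than an optimal one). -/
def IsCounterexample (m : ℕ) (c : ℕ → ℕ) (x : ℕ) : Prop :=
  ∃ γ β, IsGreedy m c x γ ∧ IsRepr m c x β ∧ reprSize m β < reprSize m γ

/-- A coin system is non-canonical if it has a counterexample. -/
def NonCanonical (m : ℕ) (c : ℕ → ℕ) : Prop :=
  ∃ x, IsCounterexample m c x

/-- A coin system is canonical if `|GRD(x)| = |OPT(x)|` for all `x`,
i.e. it has no counterexample. -/
def IsCanonical (m : ℕ) (c : ℕ → ℕ) : Prop :=
  ∀ x, ¬ IsCounterexample m c x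

/-- A coin system is tight if it has no counterexample smaller than its largest coin. -/
def Tight (m : ℕ) (c : ℕ → ℕ) : Prop :=
  ∀ x, x < c m → ¬ IsCounterexample m c x

/-- `x` is the smallest counterexample of the coin system. -/
def SmallestCounterexample (m : ℕ) (c : ℕ → ℕ) (x : ℕ) : Prop :=
  IsCounterexample m c x ∧ ∀ y, y < x → ¬ IsCounterexample m c y

/-- The number of coins used by the greedy algorithm on the amount `x`. -/
def greedyCost (c : ℕ → ℕ) : ℕ → ℕ → ℕ
  | 0, _ => 0
  | m + 1, x => x / c (m + 1) + greedyCost c m (x % c (m + 1))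

section GreedyCost

variable {c : ℕ → ℕ} {m : ℕ}

theorem greedyCost_succ (x : ℕ) :
    greedyCost c (m + 1) x = x / c (m + 1) + greedyCost c m (x % c (m + 1)) := rfl

@[simp] theorem greedyCost_zero : greedyCost c m 0 = 0 := by
  induction m with
  | zero => rfl
  | succ m ih => simp [greedyCost_succ, ih]

theorem greedyCost_succ_of_lt {x : ℕ} (h : x < c (m + 1)) :
    greedyCost c (m + 1) x = greedyCost c m x := by
  rw [greedyCost_succ, Nat.div_eq_of_lt h, Nat.mod_eq_of_lt h, zero_add]

theorem greedyCost_succ_add {x : ℕ} (h : 0 < c (m + 1)) :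
    greedyCost c (m + 1) (x + c (m + 1)) = greedyCost c (m + 1) x + 1 := by
  rw [greedyCost_succ, greedyCost_succ, Nat.add_div_right _ h, Nat.add_mod_right]
  omega

theorem greedyCost_succ_add_mul {x k : ℕ} (h : 0 < c (m + 1)) :
    greedyCost c (m + 1) (x + k * c (m + 1)) = greedyCost c (m + 1) x + k := by
  induction k with
  | zero => simp
  | succ k ih => rw [Nat.succ_mul, ← Nat.add_assoc, greedyCost_succ_add h, ih]; omega

theorem IsCoinSystem.mono {n : ℕ} (hc : IsCoinSystem m c) (h : n ≤ m) : IsCoinSystem n c :=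
  ⟨hc.1, fun i j hi hij hj => hc.2 i j hi hij (hj.trans h)⟩

theorem IsCoinSystem.pos (hc : IsCoinSystem m c) {i : ℕ} (hi : 1 ≤ i) (him : i ≤ m) :
    0 < c i := by
  have h1 := hc.1
  rcases hi.eq_or_lt with rfl | h
  · omega
  · have := hc.2 1 i le_rfl h him
    omega

theorem IsGreedy.reprSize_eq {x : ℕ} {γ : ℕ → ℕ} (hc : IsCoinSystem m c)
    (h : IsGreedy m c x γ) : reprSize m γ = greedyCost c m x := by
  induction m generalizing x with
  | zero => simp [reprSize, greedyCost]
  | succ m ih =>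
    have hpos := hc.pos (i := m + 1) (by omega) le_rfl
    set s := ∑ j ∈ Finset.Icc 1 m, γ j * c j with hs
    have hlt : s < c (m + 1) := by
      rcases Nat.eq_zero_or_pos m with rfl | hm
      · simpa [hs] using hpos
      · simpa using h.2 (m + 1) (by omega) le_rfl
    have hx : s + γ (m + 1) * c (m + 1) = x := by
      have := h.1
      rwa [IsRepr, Finset.sum_Icc_succ_top (by omega)] at this
    have hg : IsGreedy m c s γ := ⟨rfl, fun i hi him => h.2 i hi (by omega)⟩
    have hsize := ih (hc.mono (by omega)) hg
    rw [reprSize, Finset.sum_Icc_succ_top (by omega), ← reprSize, hsize, ← hx,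
      greedyCost_succ_add_mul hpos, greedyCost_succ_of_lt hlt]

theorem exists_isGreedy (hc : IsCoinSystem m c) (hm : 1 ≤ m) (x : ℕ) :
    ∃ γ, IsGreedy m c x γ := by
  induction m, hm using Nat.le_induction generalizing x with
  | base =>
    refine ⟨fun _ => x, ?_, fun i hi hi' => by omega⟩
    simp [IsRepr, hc.1]
  | succ m hm ih =>
    have hpos := hc.pos (i := m + 1) (by omega) le_rfl
    obtain ⟨γ, hγ, hγ'⟩ := ih (hc.mono (by omega)) (x % c (m + 1))
    have key : ∀ i ≤ m, ∑ j ∈ Finset.Icc 1 i,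
        Function.update γ (m + 1) (x / c (m + 1)) j * c j = ∑ j ∈ Finset.Icc 1 i, γ j * c j := by
      intro i hi
      refine Finset.sum_congr rfl fun j hj => ?_
      rw [Finset.mem_Icc] at hj
      rw [Function.update_of_ne (by omega)]
    rw [IsRepr] at hγ
    refine ⟨Function.update γ (m + 1) (x / c (m + 1)), ?_, fun i hi him => ?_⟩
    · rw [IsRepr, Finset.sum_Icc_succ_top (by omega), key m le_rfl, hγ, Function.update_self]
      exact Nat.mod_add_div' _ _
    · rw [key (i - 1) (by omega)]
      rcases him.eq_or_lt with rfl | h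
      · simpa [hγ] using Nat.mod_lt x hpos
      · exact hγ' i hi (by omega)

theorem nonCanonical_iff_not_isCanonical : NonCanonical m c ↔ ¬ IsCanonical m c := by
  simp [NonCanonical, IsCanonical]

theorem IsCanonical.greedyCost_le (hc : IsCoinSystem m c) (hm : 1 ≤ m) (h : IsCanonical m c)
    {x : ℕ} {β : ℕ → ℕ} (hβ : IsRepr m c x β) : greedyCost c m x ≤ reprSize m β := by
  obtain ⟨γ, hγ⟩ := exists_isGreedy hc hm x
  rw [← hγ.reprSize_eq hc]
  by_contra hlt
  exact h x ⟨γ, β, hγ, hβ, by omega⟩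

theorem IsCanonical.greedyCost_add_le (hc : IsCoinSystem m c) (hm : 1 ≤ m)
    (h : IsCanonical m c) (x y : ℕ) :
    greedyCost c m (x + y) ≤ greedyCost c m x + greedyCost c m y := by
  obtain ⟨γ, hγ⟩ := exists_isGreedy hc hm x
  obtain ⟨δ, hδ⟩ := exists_isGreedy hc hm y
  rw [← hγ.reprSize_eq hc, ← hδ.reprSize_eq hc, reprSize, reprSize, ← Finset.sum_add_distrib]
  refine h.greedyCost_le hc hm (β := fun i => γ i + δ i) ?_
  have h1 := hγ.1
  have h2 := hδ.1
  rw [IsRepr] at *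
  simp only [add_mul, Finset.sum_add_distrib, h1, h2]

theorem greedyCost_coin (hc : IsCoinSystem m c) {i : ℕ} (hi : 1 ≤ i) (him : i ≤ m) :
    greedyCost c m (c i) = 1 := by
  induction m with
  | zero => omega
  | succ m ih =>
    rcases him.eq_or_lt with rfl | h
    · simpa using greedyCost_succ_add (x := 0) (hc.pos hi le_rfl)
    · rw [greedyCost_succ_of_lt (hc.2 i _ hi h le_rfl)]
      exact ih (hc.mono (by omega)) (by omega)

theorem IsCanonical.greedyCost_mul_coin_le (hc : IsCoinSystem m c) (h : IsCanonical m c)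
    {i : ℕ} (hi : 1 ≤ i) (him : i ≤ m) (k : ℕ) : greedyCost c m (k * c i) ≤ k := by
  induction k with
  | zero => simp
  | succ k ih =>
    have := h.greedyCost_add_le hc (hi.trans him) (k * c i) (c i)
    rw [greedyCost_coin hc hi him] at this
    rw [Nat.succ_mul]
    omega

theorem isCanonical_of_greedyCost_add_coin_le (hc : IsCoinSystem m c)
    (h : ∀ x i, 1 ≤ i → i ≤ m → greedyCost c m (x + c i) ≤ greedyCost c m x + 1) :
    IsCanonical m c := by
  have hmul : ∀ i, 1 ≤ i → i ≤ m → ∀ x k,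
      greedyCost c m (x + k * c i) ≤ greedyCost c m x + k := by
    intro i hi him x k
    induction k with
    | zero => simp
    | succ k ih =>
      have := h (x + k * c i) i hi him
      rw [Nat.succ_mul, ← Nat.add_assoc]
      omega
  rintro x ⟨γ, β, hγ, hβ, hlt⟩
  have hsum : ∀ n ≤ m, greedyCost c m (∑ i ∈ Finset.Icc 1 n, β i * c i) ≤
      ∑ i ∈ Finset.Icc 1 n, β i := by
    intro n
    induction n with
    | zero => simp
    | succ n ih =>
      intro hn
      rw [Finset.sum_Icc_succ_top (by omega), Finset.sum_Icc_succ_top (by omega)]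
      exact (hmul (n + 1) (by omega) hn _ _).trans (Nat.add_le_add_right (ih (by omega)) _)
  have := hsum m le_rfl
  rw [IsRepr] at hβ
  rw [hβ, ← hγ.reprSize_eq hc] at this
  rw [reprSize] at hlt
  omega

/-- The one-point criterion of Magazine, Nemhauser and Trotter. -/
theorem IsCanonical.succ (hc : IsCoinSystem (m + 1) c) (hm : 1 ≤ m) (h : IsCanonical m c)
    {p : ℕ} (hp : c (m + 1) ≤ p * c m) (hp' : p * c m < c (m + 1) + c m)
    (hcost : greedyCost c (m + 1) (p * c m) ≤ p) : IsCanonical (m + 1) c := by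
  have hcm := hc.mono (n := m) (by omega)
  have hpos := hc.pos (i := m + 1) (by omega) le_rfl
  have hlt := hc.2 m (m + 1) hm (by omega) le_rfl
  obtain ⟨δ, hδ⟩ := Nat.exists_eq_add_of_le hp
  have hδcost : greedyCost c m δ + 1 ≤ p := by
    rwa [hδ, add_comm (c (m + 1)), greedyCost_succ_add hpos, greedyCost_succ_of_lt (by omega)]
      at hcost
  have hdrop : ∀ z, greedyCost c m z + 1 ≤ greedyCost c m (z + c (m + 1)) := by
    intro z
    have h1 := h.greedyCost_add_le hcm hm (z + c (m + 1)) δ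
    rw [add_assoc, ← hδ] at h1
    obtain ⟨n, rfl⟩ := Nat.exists_eq_add_of_le' hm
    rw [greedyCost_succ_add_mul (hcm.pos (by omega) le_rfl)] at h1
    omega
  refine isCanonical_of_greedyCost_add_coin_le hc fun x i hi him => ?_
  rcases him.eq_or_lt with rfl | him
  · rw [greedyCost_succ_add hpos]
  have hcoin := greedyCost_coin hcm hi (by omega)
  have hci := hc.2 i (m + 1) hi him le_rfl
  rw [← Nat.mod_add_div' x (c (m + 1)), add_right_comm, greedyCost_succ_add_mul hpos,
    greedyCost_succ_add_mul hpos]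
  have hr := Nat.mod_lt x hpos
  set r := x % c (m + 1)
  have h1 := h.greedyCost_add_le hcm hm r (c i)
  rw [greedyCost_succ_of_lt hr]
  by_cases hri : r + c i < c (m + 1)
  · rw [greedyCost_succ_of_lt hri]
    omega
  · obtain ⟨z, hz⟩ := Nat.exists_eq_add_of_le' (not_lt.1 hri)
    have := hdrop z
    rw [hz] at h1 ⊢
    rw [greedyCost_succ_add hpos, greedyCost_succ_of_lt (by omega)]
    omega

theorem IsCanonical.exists_of_not_succ (hc : IsCoinSystem (m + 1) c) (hm : 1 ≤ m)
    (h : IsCanonical m c) (h' : ¬ IsCanonical (m + 1) c) :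
    ∃ k, 1 ≤ k ∧ k * c m < c (m + 1) ∧ c (m + 1) < (k + 1) * c m ∧
      k + 1 < greedyCost c (m + 1) ((k + 1) * c m) := by
  have hcm := hc.pos (i := m) hm (by omega)
  have hlt := hc.2 m (m + 1) hm (by omega) le_rfl
  have hdiv := Nat.div_add_mod (c (m + 1) - 1) (c m)
  have hmod := Nat.mod_lt (c (m + 1) - 1) hcm
  have hk : 1 ≤ (c (m + 1) - 1) / c m := (Nat.one_le_div_iff hcm).2 (by omega)
  rw [mul_comm] at hdiv
  set k := (c (m + 1) - 1) / c m
  have hs := Nat.succ_mul k (c m)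
  rw [Nat.succ_eq_add_one] at hs
  have hcost : k + 1 < greedyCost c (m + 1) ((k + 1) * c m) := by
    by_contra hle
    exact h' (h.succ hc hm (p := k + 1) (by omega) (by omega) (by omega))
  refine ⟨k, hk, by omega, ?_, hcost⟩
  refine lt_of_le_of_ne (by omega) fun heq => ?_
  rw [← heq, greedyCost_coin hc (by omega) le_rfl] at hcost
  omega

theorem isCanonical_one (hc : IsCoinSystem 1 c) : IsCanonical 1 c := by
  refine isCanonical_of_greedyCost_add_coin_le hc fun x i hi him => ?_
  obtain rfl : i = 1 := by omega
  rw [greedyCost_succ_add (hc.pos le_rfl le_rfl)]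

theorem isCanonical_two (hc : IsCoinSystem 2 c) : IsCanonical 2 c := by
  have h1 := hc.1
  refine (isCanonical_one (hc.mono (by omega))).succ hc le_rfl (p := c 2) (by simp [h1])
    (by simp [h1]) ?_
  rw [h1, mul_one, greedyCost_coin hc (by omega) le_rfl]
  exact hc.pos (by omega) le_rfl

theorem greedyCost_pos (hc : IsCoinSystem m c) (hm : 1 ≤ m) {x : ℕ} (hx : 0 < x) :
    0 < greedyCost c m x := by
  obtain ⟨γ, hγ⟩ := exists_isGreedy hc hm x
  rw [← hγ.reprSize_eq hc]
  by_contra h0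
  have h0 : reprSize m γ = 0 := by omega
  rw [reprSize, Finset.sum_eq_zero_iff] at h0
  have := hγ.1
  rw [IsRepr, Finset.sum_eq_zero fun i hi => by rw [h0 i hi, zero_mul]] at this
  omega

/-- A positive amount on which the greedy algorithm uses one coin is a coin. -/
theorem exists_coin_of_greedyCost_le_one (hc : IsCoinSystem m c) (hm : 1 ≤ m) {x : ℕ}
    (h : greedyCost c m x ≤ 1) : x = 0 ∨ ∃ i, 1 ≤ i ∧ i ≤ m ∧ x = c i := by
  induction m, hm using Nat.le_induction with
  | base =>
    simp only [greedyCost, hc.1, Nat.div_one] at h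
    rcases Nat.eq_zero_or_pos x with h0 | h0
    · exact .inl h0
    · exact .inr ⟨1, le_rfl, le_rfl, by rw [hc.1]; omega⟩
  | succ m hm ih =>
    have hpos := hc.pos (i := m + 1) (by omega) le_rfl
    have hcm := hc.mono (n := m) (by omega)
    by_cases hx : x < c (m + 1)
    · rw [greedyCost_succ_of_lt hx] at h
      rcases ih hcm h with h0 | ⟨i, hi, him, hxi⟩
      · exact .inl h0
      · exact .inr ⟨i, hi, by omega, hxi⟩
    · obtain ⟨z, rfl⟩ := Nat.exists_eq_add_of_le' (not_lt.1 hx)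
      rw [greedyCost_succ_add hpos] at h
      rcases Nat.eq_zero_or_pos z with rfl | hz
      · exact .inr ⟨m + 1, by omega, le_rfl, by simp⟩
      · have := greedyCost_pos hc (by omega) hz
        omega

theorem greedyCost_eq_of_lt (hc : IsCoinSystem m c) {j x : ℕ} (hjm : j ≤ m)
    (h : ∀ i, j < i → i ≤ m → x < c i) : greedyCost c m x = greedyCost c j x := by
  induction m, hjm using Nat.le_induction with
  | base => rfl
  | succ m hm ih =>
    rw [greedyCost_succ_of_lt (h (m + 1) (by omega) le_rfl)]
    exact ih (hc.mono (by omega)) fun i hi him => h i hi (by omega)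

/-- In a canonical system, a sum of two coins is the largest coin below it, plus at most one
further coin. -/
theorem IsCanonical.coin_add_coin (hc : IsCoinSystem m c) (h : IsCanonical m c)
    {u v j : ℕ} (hu : 1 ≤ u) (hum : u ≤ m) (hv : 1 ≤ v) (hvm : v ≤ m) (hj : 1 ≤ j) (hjm : j ≤ m)
    (hle : c j ≤ c u + c v) (hlt : j + 1 ≤ m → c u + c v < c (j + 1)) :
    c u + c v = c j ∨ ∃ i, 1 ≤ i ∧ i ≤ j ∧ c u + c v = c j + c i := by
  have hcost := h.greedyCost_add_le hc (hu.trans hum) (c u) (c v)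
  rw [greedyCost_coin hc hu hum, greedyCost_coin hc hv hvm] at hcost
  rw [greedyCost_eq_of_lt hc hjm] at hcost
  · obtain ⟨z, hz⟩ := Nat.exists_eq_add_of_le' hle
    have hcj := hc.mono hjm
    obtain ⟨n, rfl⟩ := Nat.exists_eq_add_of_le' hj
    rw [hz, greedyCost_succ_add (hcj.pos hj le_rfl)] at hcost
    rcases exists_coin_of_greedyCost_le_one hcj hj (x := z) (by omega) with h0 | ⟨i, hi, him, hzi⟩
    · exact .inl (by omega)
    · exact .inr ⟨i, hi, him, by omega⟩
  · intro i hi him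
    have h1 := hlt (by omega)
    rcases (Nat.succ_le_of_lt hi).eq_or_lt with h2 | h2
    · rwa [← h2]
    · exact h1.trans (hc.2 _ _ (by omega) h2 him)

end GreedyCost

section FiveCoins

variable {c : ℕ → ℕ}

theorem IsCanonical.coin_add_coin_five (hc : IsCoinSystem 5 c) (h : IsCanonical 5 c)
    {u v : ℕ} (hu : 1 ≤ u) (hum : u ≤ 5) (hv : 1 ≤ v) (hvm : v ≤ 5) (hle : c 4 ≤ c u + c v) :
    (c u + c v < c 5 ∧ (c u + c v = c 4 ∨ c u + c v = c 4 + 1 ∨ c u + c v = c 4 + c 2 ∨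
      c u + c v = c 4 + c 3 ∨ c u + c v = c 4 + c 4)) ∨
    (c 5 ≤ c u + c v ∧ (c u + c v = c 5 ∨ c u + c v = c 5 + 1 ∨ c u + c v = c 5 + c 2 ∨
      c u + c v = c 5 + c 3 ∨ c u + c v = c 5 + c 4 ∨ c u + c v = c 5 + c 5)) := by
  have h1 := hc.1
  by_cases hlt : c u + c v < c 5
  · left
    rcases h.coin_add_coin hc hu hum hv hvm (j := 4) (by omega) (by omega) hle (fun _ => hlt)
      with h0 | ⟨i, hi, hi', hs⟩
    · omega
    · interval_cases i <;> omega
  · right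
    rcases h.coin_add_coin hc hu hum hv hvm (j := 5) (by omega) (by omega) (by omega)
      (by omega) with h0 | ⟨i, hi, hi', hs⟩
    · omega
    · interval_cases i <;> omega

theorem IsCanonical.three_of_five (hc : IsCoinSystem 5 c) (h : IsCanonical 5 c) :
    IsCanonical 3 c := by
  by_contra h3
  have h1 := hc.1
  have h12 := hc.2 1 2 (by omega) (by omega) (by omega)
  have h23 := hc.2 2 3 (by omega) (by omega) (by omega)
  have h34 := hc.2 3 4 (by omega) (by omega) (by omega)
  have h45 := hc.2 4 5 (by omega) (by omega) (by omega)
  have hc3 := hc.mono (n := 3) (by omega)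
  obtain ⟨k, hk, hlo, hhi, hcost⟩ :=
    (isCanonical_two (hc.mono (by omega))).exists_of_not_succ hc3 (by omega) h3
  norm_num at hlo hhi hcost
  have hs := Nat.succ_mul k (c 2)
  rw [Nat.succ_eq_add_one] at hs
  have h5 := h.greedyCost_mul_coin_le hc (i := 2) (by omega) (by omega) (k + 1)
  have h4le : c 4 ≤ (k + 1) * c 2 := by
    by_contra hlt
    rw [greedyCost_eq_of_lt hc (j := 3) (by omega) fun i hi hi' => by
      interval_cases i <;> omega] at h5
    omega
  have hδ : c 3 + k < (k + 1) * c 2 := by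
    obtain ⟨δ, hδ⟩ := Nat.exists_eq_add_of_le' hhi.le
    rw [hδ, greedyCost_succ_add (show 0 < c 3 by omega),
      greedyCost_eq_of_lt hc3 (j := 1) (by omega) fun i hi hi' => by
        interval_cases i <;> omega] at hcost
    simp only [greedyCost, zero_add, h1, Nat.div_one] at hcost
    omega
  have hk' : k = 1 ∨ 2 * c 2 < c 3 := by
    rcases hk.eq_or_lt with hk | hk
    · exact .inl hk.symm
    · exact .inr ((Nat.mul_le_mul_right _ hk).trans_lt hlo)
  have e23 := h.coin_add_coin_five hc (u := 2) (v := 3) (by omega) (by omega) (by omega)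
    (by omega) (by omega)
  have e24 := h.coin_add_coin_five hc (u := 2) (v := 4) (by omega) (by omega) (by omega)
    (by omega) (by omega)
  have e33 := h.coin_add_coin_five hc (u := 3) (v := 3) (by omega) (by omega) (by omega)
    (by omega) (by omega)
  have e34 := h.coin_add_coin_five hc (u := 3) (v := 4) (by omega) (by omega) (by omega)
    (by omega) (by omega)
  have e44 := h.coin_add_coin_five hc (u := 4) (v := 4) (by omega) (by omega) (by omega)
    (by omega) (by omega)
  have hcases : c 5 = c 2 + c 3 ∨ c 5 + 1 = c 2 + c 3 ∨ c 4 + 1 = c 2 + c 3 := by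
    clear e24 e33 e34 e44
    omega
  rcases hk' with rfl | hk'
  · rcases hcases with h0 | h0 | h0
    · omega
    · omega
    · omega
  · rcases hcases with h0 | h0 | h0
    · clear e23 e33 e44
      omega
    · clear e23 e33 e34 e44
      omega
    · omega

theorem IsCanonical.four_or_of_five (hc : IsCoinSystem 5 c) (h : IsCanonical 5 c)
    (h4 : ¬ IsCanonical 4 c) : c 2 = 2 ∧ c 4 = c 3 + 1 ∧ c 5 = 2 * c 3 := by
  have h1 := hc.1
  have h12 := hc.2 1 2 (by omega) (by omega) (by omega)
  have h23 := hc.2 2 3 (by omega) (by omega) (by omega)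
  have h34 := hc.2 3 4 (by omega) (by omega) (by omega)
  have h45 := hc.2 4 5 (by omega) (by omega) (by omega)
  have hc4 := hc.mono (n := 4) (by omega)
  obtain ⟨k, hk, hlo, hhi, hcost⟩ :=
    (h.three_of_five hc).exists_of_not_succ hc4 (by omega) h4
  norm_num at hlo hhi hcost
  have hs := Nat.succ_mul k (c 3)
  rw [Nat.succ_eq_add_one] at hs
  have h5le : c 5 ≤ (k + 1) * c 3 := by
    by_contra hlt
    have h5 := h.greedyCost_mul_coin_le hc (i := 3) (by omega) (by omega) (k + 1)
    rw [greedyCost_succ_of_lt (show _ < c 5 by omega)] at h5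
    omega
  have hk' : k = 1 ∨ 2 * c 3 < c 4 := by
    rcases hk.eq_or_lt with hk | hk
    · exact .inl hk.symm
    · exact .inr ((Nat.mul_le_mul_right _ hk).trans_lt hlo)
  have hne : 2 * c 3 = c 4 + c 2 → k ≠ 1 := by
    rintro h0 rfl
    norm_num at hcost
    rw [h0, add_comm, greedyCost_succ_add (show 0 < c 4 by omega),
      greedyCost_coin hc4 (by omega) (by omega)] at hcost
    omega
  have e34 := h.coin_add_coin_five hc (u := 3) (v := 4) (by omega) (by omega) (by omega)
    (by omega) (by omega)
  have e44 := h.coin_add_coin_five hc (u := 4) (v := 4) (by omega) (by omega) (by omega)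
    (by omega) (by omega)
  have hcases : c 5 + 1 = c 3 + c 4 ∨ c 5 + c 2 = c 3 + c 4 := by
    clear e44
    omega
  rcases hcases with h0 | h0
  · rcases hk' with rfl | hk'
    · omega
    · omega
  · rcases hk' with rfl | hk'
    · omega
    · omega

theorem isCanonical_one_two_succ_double (hc : IsCoinSystem 5 c) (h2 : c 2 = 2)
    (h4 : c 4 = c 3 + 1) (h5 : c 5 = 2 * c 3) : IsCanonical 5 c := by
  have h1 := hc.1
  have h23 := hc.2 2 3 (by omega) (by omega) (by omega)
  have hpos := hc.pos (i := 5) (by omega) le_rfl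
  have hlow : ∀ y, y < c 3 → greedyCost c 3 y = (y + 1) / 2 := by
    intro y hy
    rw [greedyCost_succ_of_lt hy]
    simp only [greedyCost, zero_add, Nat.reduceAdd, h1, h2, Nat.div_one]
    omega
  have hcost : ∀ r, r < c 5 → greedyCost c 5 r =
      if r < c 3 then (r + 1) / 2 else if r = c 3 then 1 else (r - c 3 + 2) / 2 := by
    intro r hr
    rw [greedyCost_succ_of_lt hr]
    split_ifs with h h'
    · rw [greedyCost_succ_of_lt (show r < c 4 by omega), hlow r h]
    · rw [h']
      exact greedyCost_coin (hc.mono (by omega)) (by omega) (by omega)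
    · obtain ⟨z, hz⟩ := Nat.exists_eq_add_of_le' (show c 4 ≤ r by omega)
      rw [hz, greedyCost_succ_add (show 0 < c 4 by omega),
        greedyCost_succ_of_lt (show z < c 4 by omega), hlow z (by omega)]
      omega
  refine isCanonical_of_greedyCost_add_coin_le hc fun x i hi him => ?_
  rcases him.eq_or_lt with rfl | him
  · rw [greedyCost_succ_add hpos]
  rw [← Nat.mod_add_div' x (c 5), add_right_comm, greedyCost_succ_add_mul hpos,
    greedyCost_succ_add_mul hpos]
  have hr := Nat.mod_lt x hpos
  set r := x % c 5
  have hci : c i = 1 ∨ c i = 2 ∨ c i = c 3 ∨ c i = c 3 + 1 := by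
    interval_cases i <;> omega
  rw [hcost r hr]
  by_cases hri : r + c i < c 5
  · rw [hcost _ hri]
    split_ifs <;> omega
  · obtain ⟨z, hz⟩ := Nat.exists_eq_add_of_le' (not_lt.1 hri)
    rw [hz, greedyCost_succ_add hpos, hcost z (by omega)]
    split_ifs <;> omega

end FiveCoins

/-- A coin system `⟨1, c 2, c 3, c 4, c 5⟩` is non-canonical iff either
(1) `⟨1, c 2, c 3, c 4⟩` is non-canonical and the system is not of the form
`⟨1, 2, c 3, c 3 + 1, 2 * c 3⟩`, or (2) `⟨1, c 2, c 3, c 4⟩` is canonical and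
`|GRD((k+1) * c 4)| > k + 1` for the `k` with `k * c 4 < c 5 < (k+1) * c 4`. -/
theorem stmt_10 (c : ℕ → ℕ) (hc : IsCoinSystem 5 c) :
    NonCanonical 5 c ↔
      ((NonCanonical 4 c ∧ ¬(c 2 = 2 ∧ c 4 = c 3 + 1 ∧ c 5 = 2 * c 3)) ∨
        (IsCanonical 4 c ∧ ∃ k : ℕ, k * c 4 < c 5 ∧ c 5 < (k + 1) * c 4 ∧
          ∃ γ, IsGreedy 5 c ((k + 1) * c 4) γ ∧ k + 1 < reprSize 5 γ)) := by
  rw [nonCanonical_iff_not_isCanonical, nonCanonical_iff_not_isCanonical]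
  constructor
  · intro h5
    by_cases h4 : IsCanonical 4 c
    · obtain ⟨k, -, hlo, hhi, hcost⟩ := h4.exists_of_not_succ hc (by omega) h5
      obtain ⟨γ, hγ⟩ := exists_isGreedy hc (by omega) ((k + 1) * c 4)
      exact .inr ⟨h4, k, hlo, hhi, γ, hγ, by rwa [hγ.reprSize_eq hc]⟩
    · exact .inl ⟨h4, fun ⟨h2, h3, h5'⟩ => h5 (isCanonical_one_two_succ_double hc h2 h3 h5')⟩
  · rintro (⟨h4, hform⟩ | ⟨-, k, -, -, γ, hγ, hcost⟩) h5
    · exact hform (h5.four_or_of_five hc h4)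
    · rw [hγ.reprSize_eq hc] at hcost
      have := h5.greedyCost_mul_coin_le hc (i := 4) (by omega) (by omega) (k + 1)
      omega
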